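/- Let φ and Φ be the standard normal density and cumulative distribution function. Then for every real x: 0 < x·φ(x)·Φ(x) + φ(x)² < Φ(x)²; equivalently, the function h(x) = (x φ(x) Φ(x) + φ(x)²)/Φ(x)² takes values in the open interval (0, 1) for all x ∈ ℝ. Moreover, h is strictly decreasing on ℝ. -/

import Mathlib

open MeasureTheory

noncomputable section

/-- The standard normal probability density `φ(x) = (1/√(2π)) e^{−x²/2}`. -/
def stdNormalPDF (x : ℝ) : ℝ :=
  (Real.sqrt (2 * Real.pi))⁻¹ * Real.exp (-x ^ 2 / 2)

/-- The standard normal cumulative distribution function `Φ(x) = ∫_{−∞}^x φ`. -/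
def stdNormalCDF (x : ℝ) : ℝ := ∫ t in Set.Iio x, stdNormalPDF t

/-- The function `h(x) = (x φ(x) Φ(x) + φ(x)²) / Φ(x)²`, arising as the second
derivative of the negative log-likelihood of a censored Gaussian observation. -/
def censoredHessian (x : ℝ) : ℝ :=
  (x * stdNormalPDF x * stdNormalCDF x + stdNormalPDF x ^ 2) / stdNormalCDF x ^ 2

lemma cH_pos_of_deriv {G G' : ℝ → ℝ} (hG : ∀ x, HasDerivAt G (G' x) x) (hp : ∀ x, 0 < G' x)
    (hl : Filter.Tendsto G Filter.atBot (nhds 0)) (x : ℝ) : 0 < G x := by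
  have hs : StrictMono G := strictMono_of_deriv_pos (fun x => by rw [(hG x).deriv]; exact hp x)
  have h1 : 0 ≤ G (x - 1) := hs.monotone.le_of_tendsto hl (x - 1)
  have h2 : G (x - 1) < G x := hs (by linarith)
  linarith

lemma cH_pdf_pos (x : ℝ) : 0 < stdNormalPDF x := by
  unfold stdNormalPDF
  have := Real.pi_pos
  positivity

lemma cH_pdf_deriv (x : ℝ) : HasDerivAt stdNormalPDF (-(x * stdNormalPDF x)) x := by
  have h1 : HasDerivAt (fun x : ℝ => -x ^ 2 / 2) (-x) x := by
    have := ((hasDerivAt_id x).pow 2).neg.div_const 2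
    refine HasDerivAt.congr_deriv this ?_
    simp
    ring
  have h2 := (h1.exp).const_mul ((Real.sqrt (2 * Real.pi))⁻¹)
  refine HasDerivAt.congr_deriv h2 ?_
  unfold stdNormalPDF
  ring

lemma cH_pdf_cont : Continuous stdNormalPDF := by
  unfold stdNormalPDF
  fun_prop

lemma cH_pdf_le (x : ℝ) : stdNormalPDF x ≤ Real.exp (1 / 2) * Real.exp x := by
  unfold stdNormalPDF
  have h1 : (Real.sqrt (2 * Real.pi))⁻¹ ≤ 1 := by
    apply inv_le_one_of_one_le₀
    rw [Real.one_le_sqrt]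
    linarith [Real.pi_gt_three]
  have h2 : Real.exp (-x ^ 2 / 2) ≤ Real.exp (1 / 2 + x) := by
    apply Real.exp_le_exp.mpr
    nlinarith [sq_nonneg (x + 1)]
  rw [← Real.exp_add]
  calc _ ≤ 1 * Real.exp (-x ^ 2 / 2) := by gcongr
    _ ≤ _ := by linarith

lemma cH_int : Integrable stdNormalPDF := by
  have := (integrable_exp_neg_mul_sq (b := 1 / 2) (by norm_num)).const_mul
    ((Real.sqrt (2 * Real.pi))⁻¹)
  convert this using 1
  funext x
  unfold stdNormalPDF
  congr 2
  ring

lemma cH_cdf_eq (x : ℝ) : stdNormalCDF x = ∫ t in Set.Iic x, stdNormalPDF t := by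
  unfold stdNormalCDF
  rw [integral_Iic_eq_integral_Iio]

lemma cH_cdf_deriv (x : ℝ) : HasDerivAt stdNormalCDF (stdNormalPDF x) x := by
  have h : stdNormalCDF = fun x => (∫ t in (0 : ℝ)..x, stdNormalPDF t) + stdNormalCDF 0 := by
    funext y
    rw [cH_cdf_eq, cH_cdf_eq, ← intervalIntegral.integral_Iic_sub_Iic cH_int.integrableOn
      cH_int.integrableOn]
    ring
  rw [h]
  exact (intervalIntegral.integral_hasDerivAt_right (cH_pdf_cont.intervalIntegrable _ _)
    (cH_pdf_cont.stronglyMeasurableAtFilter _ _) cH_pdf_cont.continuousAt).add_const _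

lemma cH_cdf_nonneg (x : ℝ) : 0 ≤ stdNormalCDF x :=
  integral_nonneg (fun t => (cH_pdf_pos t).le)

lemma cH_cdf_le (x : ℝ) : stdNormalCDF x ≤ Real.exp (1 / 2) * Real.exp x := by
  rw [cH_cdf_eq, ← integral_exp_Iic x, ← integral_const_mul]
  exact setIntegral_mono cH_int.integrableOn ((integrableOn_exp_Iic x).const_mul _) cH_pdf_le

lemma cH_lim {g : ℝ → ℝ} (h0 : ∀ x, 0 ≤ g x) (h1 : ∀ x, g x ≤ Real.exp (1 / 2) * Real.exp x)
    (n : ℕ) : Filter.Tendsto (fun x => x ^ n * g x) Filter.atBot (nhds 0) := by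
  have h2 := ((Real.tendsto_pow_mul_exp_neg_atTop_nhds_zero n).comp
    Filter.tendsto_neg_atBot_atTop).const_mul (Real.exp (1 / 2))
  rw [mul_zero] at h2
  refine squeeze_zero_norm' ?_ h2
  filter_upwards [Filter.eventually_le_atBot 0] with x hx
  simp only [Function.comp, neg_neg, norm_mul, norm_pow, Real.norm_eq_abs, abs_of_nonneg (h0 x),
    abs_of_nonpos hx]
  have : 0 ≤ (-x) ^ n := pow_nonneg (by linarith) n
  nlinarith [mul_le_mul_of_nonneg_left (h1 x) this]

lemma cH_limf (n : ℕ) :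
    Filter.Tendsto (fun x => x ^ n * stdNormalPDF x) Filter.atBot (nhds 0) :=
  cH_lim (fun x => (cH_pdf_pos x).le) cH_pdf_le n

lemma cH_limF (n : ℕ) :
    Filter.Tendsto (fun x => x ^ n * stdNormalCDF x) Filter.atBot (nhds 0) :=
  cH_lim cH_cdf_nonneg cH_cdf_le n

lemma cH_cdf_pos (x : ℝ) : 0 < stdNormalCDF x :=
  cH_pos_of_deriv cH_cdf_deriv cH_pdf_pos (by simpa using cH_limF 0) x

/-- First iterated integral. -/
def cHA (x : ℝ) : ℝ := x * stdNormalCDF x + stdNormalPDF x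

lemma cHA_deriv (x : ℝ) : HasDerivAt cHA (stdNormalCDF x) x := by
  have := ((hasDerivAt_id x).mul (cH_cdf_deriv x)).add (cH_pdf_deriv x)
  refine HasDerivAt.congr_deriv this ?_
  simp

lemma cHA_lim : Filter.Tendsto cHA Filter.atBot (nhds 0) := by
  have := (cH_limF 1).add (cH_limf 0)
  simpa [show cHA = fun x => x * stdNormalCDF x + stdNormalPDF x from rfl] using this

lemma cHA_pos (x : ℝ) : 0 < cHA x := cH_pos_of_deriv cHA_deriv cH_cdf_pos cHA_lim x

/-- Twice the second iterated integral. -/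
def cHB (x : ℝ) : ℝ := x * cHA x + stdNormalCDF x

lemma cHB_deriv (x : ℝ) : HasDerivAt cHB (2 * cHA x) x := by
  have := ((hasDerivAt_id x).mul (cHA_deriv x)).add (cH_cdf_deriv x)
  refine HasDerivAt.congr_deriv this ?_
  simp only [id, cHA]
  ring

lemma cHB_lim : Filter.Tendsto cHB Filter.atBot (nhds 0) := by
  have := ((cH_limF 2).add (cH_limf 1)).add (cH_limF 0)
  simp only [add_zero] at this
  refine this.congr fun x => ?_
  simp only [cHB, cHA]
  ring

lemma cHB_pos (x : ℝ) : 0 < cHB x :=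
  cH_pos_of_deriv cHB_deriv (fun x => by linarith [cHA_pos x]) cHB_lim x

/-- Six times the third iterated integral. -/
def cHT (x : ℝ) : ℝ := x * cHB x + 2 * cHA x

lemma cHT_deriv (x : ℝ) : HasDerivAt cHT (3 * cHB x) x := by
  have := ((hasDerivAt_id x).mul (cHB_deriv x)).add ((cHA_deriv x).const_mul 2)
  refine HasDerivAt.congr_deriv this ?_
  simp only [id, cHB]
  ring

lemma cHT_lim : Filter.Tendsto cHT Filter.atBot (nhds 0) := by
  have := (((cH_limF 3).add (cH_limf 2)).add (cH_limF 1)).add (cHA_lim.const_mul 2)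
  simp only [add_zero, mul_zero] at this
  refine this.congr fun x => ?_
  simp only [cHT, cHB, cHA]
  ring

lemma cHT_pos (x : ℝ) : 0 < cHT x :=
  cH_pos_of_deriv cHT_deriv (fun x => by linarith [cHB_pos x]) cHT_lim x

lemma cH_E2 (x : ℝ) : 0 < stdNormalCDF x - cHA x * stdNormalPDF x / stdNormalCDF x := by
  refine cH_pos_of_deriv
    (G := fun x => stdNormalCDF x - cHA x * stdNormalPDF x / stdNormalCDF x)
    (G' := fun x => cHA x * (stdNormalPDF x * cHA x) / stdNormalCDF x ^ 2) ?_ ?_ ?_ x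
  · intro x
    have hF := (cH_cdf_pos x).ne'
    have := (cH_cdf_deriv x).sub (((cHA_deriv x).mul (cH_pdf_deriv x)).div (cH_cdf_deriv x) hF)
    refine HasDerivAt.congr_deriv this ?_
    simp only [Pi.mul_apply]
    field_simp
    simp only [cHA]
    ring
  · intro x
    have := cHA_pos x
    have := cH_pdf_pos x
    have := cH_cdf_pos x
    positivity
  · have h1 : Filter.Tendsto (fun x => cHA x * stdNormalPDF x / stdNormalCDF x)
        Filter.atBot (nhds 0) := by
      have h2 := cH_limf 0
      simp only [pow_zero, one_mul] at h2
      refine squeeze_zero' (Filter.Eventually.of_forall fun x => ?_) ?_ h2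
      · have := cHA_pos x
        have := cH_pdf_pos x
        have := cH_cdf_pos x
        positivity
      · filter_upwards [Filter.eventually_le_atBot (-1)] with x hx
        have hA := cHA_pos x
        have hf := cH_pdf_pos x
        have hF := cH_cdf_pos x
        have hB := cHB_pos x
        rw [div_le_iff₀ hF]
        have : cHA x ≤ stdNormalCDF x := by
          unfold cHB at hB
          nlinarith
        nlinarith
    have := (cH_limF 0).sub h1
    simpa using this

lemma cH_upper (x : ℝ) : cHA x * stdNormalPDF x < stdNormalCDF x ^ 2 := by
  have h := cH_E2 x
  have hF := cH_cdf_pos x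
  rw [sub_pos, div_lt_iff₀ hF] at h
  linarith

lemma cH_E3 (x : ℝ) : 0 < cHA x - cHB x * stdNormalCDF x / (2 * cHA x) := by
  refine cH_pos_of_deriv
    (G := fun x => cHA x - cHB x * stdNormalCDF x / (2 * cHA x))
    (G' := fun x => cHB x * (stdNormalCDF x ^ 2 - cHA x * stdNormalPDF x) / (2 * cHA x ^ 2))
    ?_ ?_ ?_ x
  · intro x
    have hA := (cHA_pos x).ne'
    have := (cHA_deriv x).sub (((cHB_deriv x).mul (cH_cdf_deriv x)).div
      ((cHA_deriv x).const_mul 2) (by positivity))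
    refine HasDerivAt.congr_deriv this ?_
    simp only [Pi.mul_apply]
    field_simp
    ring
  · intro x
    have := cHA_pos x
    have := cHB_pos x
    have := sub_pos.mpr (cH_upper x)
    positivity
  · have h1 : Filter.Tendsto (fun x => cHB x * stdNormalCDF x / (2 * cHA x))
        Filter.atBot (nhds 0) := by
      have h2 := cH_limF 0
      simp only [pow_zero, one_mul] at h2
      refine squeeze_zero' (Filter.Eventually.of_forall fun x => ?_) ?_ h2
      · have := cHA_pos x
        have := cHB_pos x
        have := cH_cdf_pos x
        positivity
      · filter_upwards [Filter.eventually_le_atBot (-1)] with x hx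
        have hA := cHA_pos x
        have hF := cH_cdf_pos x
        have hB := cHB_pos x
        have hT := cHT_pos x
        rw [div_le_iff₀ (by positivity)]
        have : cHB x ≤ 2 * cHA x := by
          unfold cHT at hT
          nlinarith
        nlinarith
    have := cHA_lim.sub h1
    simpa using this

lemma cH_sampford (x : ℝ) :
    stdNormalCDF x ^ 2 < cHA x * (x * stdNormalCDF x + 2 * stdNormalPDF x) := by
  have h := cH_E3 x
  have hA := cHA_pos x
  rw [sub_pos, div_lt_iff₀ (by positivity)] at h
  unfold cHB at h
  have : x * stdNormalCDF x + 2 * stdNormalPDF x = 2 * cHA x - x * stdNormalCDF x := by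
    unfold cHA
    ring
  rw [this]
  nlinarith

lemma cH_num (x : ℝ) : x * stdNormalPDF x * stdNormalCDF x + stdNormalPDF x ^ 2 =
    cHA x * stdNormalPDF x := by
  unfold cHA
  ring

lemma cH_deriv (x : ℝ) : HasDerivAt censoredHessian
    (stdNormalPDF x * (stdNormalCDF x ^ 2 - cHA x * (x * stdNormalCDF x + 2 * stdNormalPDF x))
      / stdNormalCDF x ^ 3) x := by
  have hF := (cH_cdf_pos x).ne'
  have he : censoredHessian = fun x => cHA x * stdNormalPDF x / stdNormalCDF x ^ 2 := by
    funext y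
    rw [censoredHessian, cH_num]
  rw [he]
  have := ((cHA_deriv x).mul (cH_pdf_deriv x)).div ((cH_cdf_deriv x).pow 2) (pow_ne_zero 2 hF)
  refine HasDerivAt.congr_deriv this ?_
  simp only [Pi.mul_apply, Pi.pow_apply]
  field_simp
  ring

/-- For every real `x`, `0 < x·φ(x)·Φ(x) + φ(x)² < Φ(x)²`; equivalently
`h(x) = (x φ(x) Φ(x) + φ(x)²)/Φ(x)² ∈ (0, 1)`.  Moreover `h` is strictly
decreasing on `ℝ`. -/
theorem censoredHessian_mem_Ioo_and_strictAnti :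
    (∀ x : ℝ,
      0 < x * stdNormalPDF x * stdNormalCDF x + stdNormalPDF x ^ 2 ∧
      x * stdNormalPDF x * stdNormalCDF x + stdNormalPDF x ^ 2 < stdNormalCDF x ^ 2) ∧
    (∀ x : ℝ, censoredHessian x ∈ Set.Ioo (0 : ℝ) 1) ∧
    StrictAnti censoredHessian := by
  have h1 : ∀ x : ℝ,
      0 < x * stdNormalPDF x * stdNormalCDF x + stdNormalPDF x ^ 2 ∧
      x * stdNormalPDF x * stdNormalCDF x + stdNormalPDF x ^ 2 < stdNormalCDF x ^ 2 := by
    intro x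
    rw [cH_num]
    exact ⟨mul_pos (cHA_pos x) (cH_pdf_pos x), cH_upper x⟩
  refine ⟨h1, fun x => ?_, ?_⟩
  · have hF : 0 < stdNormalCDF x ^ 2 := pow_pos (cH_cdf_pos x) 2
    exact ⟨div_pos (h1 x).1 hF, (div_lt_one hF).mpr (h1 x).2⟩
  · refine strictAnti_of_deriv_neg fun x => ?_
    rw [(cH_deriv x).deriv]
    exact div_neg_of_neg_of_pos
      (mul_neg_of_pos_of_neg (cH_pdf_pos x) (sub_neg.mpr (cH_sampford x)))
      (pow_pos (cH_cdf_pos x) 3)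

end
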